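/- Open branching satisfies the identity law up to isomorphism: if ρ := λ₂ ←λ₂⁺ λ₀ →λ₃⁺ λ₃ is a span of in-markers in which λ₀ ≅ λ₂ (so that λ₂ is a trivial computon and the in-marker λ₂⁺ is an isomorphism), then the open branching computon λ₂ ?_ρ λ₃ is isomorphic to λ₃. -/

import Mathlib

namespace Computons

/-- A computon (Definition 1 of the paper). -/
structure Computon : Type 1 where
  U : Type
  P : Type
  I : Type
  O : Type
  finU : Finite U
  finP : Finite P
  finI : Finite I
  finO : Finite O
  neP : Nonempty P
  types : Finset ℕ
  B : Finset String
  sigma : O → U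
  t : O → P
  tau : I → U
  s : I → P
  c : P → ℕ
  r : I → O
  f : O → String
  c_mem : ∀ p, c p ∈ types
  f_mem : ∀ o, f o ∈ B
  sigma_surj : Function.Surjective sigma
  tau_surj : Function.Surjective tau
  r_surj : Function.Surjective r
  zero_mem : 0 ∈ types
  tau_ctrl : ∀ u, ∃ i, c (s i) = 0 ∧ tau i = u
  sigma_ctrl : ∀ u, ∃ o, c (t o) = 0 ∧ sigma o = u
  sigma_r : ∀ i, sigma (r i) = tau i
  ctrl_inport : ∃ p, p ∉ Set.range t ∧ c p = 0
  ctrl_outport : ∃ q, q ∉ Set.range s ∧ c q = 0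

/-- Inports `P⁺ = P \ t(O)`. -/
def inports (A : Computon) : Set A.P := {p | p ∉ Set.range A.t}

/-- Outports `P⁻ = P \ s(I)`. -/
def outports (A : Computon) : Set A.P := {p | p ∉ Set.range A.s}

/-- `•p = σ(t⁻¹(p))`. -/
def preUnits (A : Computon) (p : A.P) : Set A.U := A.sigma '' (A.t ⁻¹' {p})

/-- `p• = τ(s⁻¹(p))`. -/
def postUnits (A : Computon) (p : A.P) : Set A.U := A.tau '' (A.s ⁻¹' {p})

/-- A computon morphism (Definition of the paper).  The Σ- and B-components are
inclusions, hence represented by the subset conditions `typesSub`, `bSub` together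
with the commutation equations `comm_c`, `comm_f`. -/
structure Hom (A B : Computon) where
  fU : A.U → B.U
  fP : A.P → B.P
  fI : A.I → B.I
  fO : A.O → B.O
  typesSub : A.types ⊆ B.types
  bSub : A.B ⊆ B.B
  comm_tau : ∀ i, B.tau (fI i) = fU (A.tau i)
  comm_sigma : ∀ o, B.sigma (fO o) = fU (A.sigma o)
  comm_s : ∀ i, B.s (fI i) = fP (A.s i)
  comm_t : ∀ o, B.t (fO o) = fP (A.t o)
  comm_c : ∀ p, B.c (fP p) = A.c p
  comm_r : ∀ i, B.r (fI i) = fO (A.r i)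
  comm_f : ∀ o, B.f (fO o) = A.f o
  boundary : ∀ p : A.P,
    ((preUnits B (fP p) \ fU '' preUnits A p).Nonempty ∨
     (postUnits B (fP p) \ fU '' postUnits A p).Nonempty) →
    p ∈ inports A ∪ outports A

/-- `ı(α)`. -/
def iVec {A B : Computon} (α : Hom A B) : Set A.P :=
  {p | (preUnits B (α.fP p) \ α.fU '' preUnits A p).Nonempty}

/-- `o(α)`. -/
def oVec {A B : Computon} (α : Hom A B) : Set A.P :=
  {p | (postUnits B (α.fP p) \ α.fU '' postUnits A p).Nonempty}

/-- Computon monomorphism: all components injective (the Σ- and B-components,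
being inclusions, are automatically injective). -/
def IsMono {A B : Computon} (α : Hom A B) : Prop :=
  Function.Injective α.fU ∧ Function.Injective α.fP ∧
  Function.Injective α.fI ∧ Function.Injective α.fO

/-- Trivial computon: `U = I = O = ∅`. -/
def IsTrivial (A : Computon) : Prop := IsEmpty A.U ∧ IsEmpty A.I ∧ IsEmpty A.O

/-- Primitive computon: `|U| = 1`, `|P| = |I| + |O|`, and `s`, `t` injective. -/
def IsPrimitive (A : Computon) : Prop :=
  Nat.card A.U = 1 ∧ Nat.card A.P = Nat.card A.I + Nat.card A.O ∧
  Function.Injective A.s ∧ Function.Injective A.t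

/-- A glue: a primitive computon all of whose ports have type `0`. -/
def IsGlue (A : Computon) : Prop := IsPrimitive A ∧ ∀ p, A.c p = 0

/-- `CompEq g f h` expresses that the composite `g ∘ f` equals `h`
(componentwise; the Σ- and B-components are inclusions, hence determined). -/
def CompEq {A B C : Computon} (g : Hom B C) (f : Hom A B) (h : Hom A C) : Prop :=
  g.fU ∘ f.fU = h.fU ∧ g.fP ∘ f.fP = h.fP ∧ g.fI ∘ f.fI = h.fI ∧ g.fO ∘ f.fO = h.fO

/-- Commutativity of a square `β₁ ∘ α₁ = β₂ ∘ α₂` (componentwise). -/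
def CommSq {A B C D : Computon} (α₁ : Hom A B) (α₂ : Hom A C)
    (β₁ : Hom B D) (β₂ : Hom C D) : Prop :=
  β₁.fU ∘ α₁.fU = β₂.fU ∘ α₂.fU ∧ β₁.fP ∘ α₁.fP = β₂.fP ∘ α₂.fP ∧
  β₁.fI ∘ α₁.fI = β₂.fI ∘ α₂.fI ∧ β₁.fO ∘ α₁.fO = β₂.fO ∘ α₂.fO

/-- `β₁`, `β₂` form a pushout cocone of the span `(α₁, α₂)` in the
category of computons (universal property). -/
def IsPushout {L0 L1 L2 L3 : Computon} (α₁ : Hom L0 L1) (α₂ : Hom L0 L2)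
    (β₁ : Hom L1 L3) (β₂ : Hom L2 L3) : Prop :=
  CommSq α₁ α₂ β₁ β₂ ∧
  ∀ (L4 : Computon) (γ₁ : Hom L1 L4) (γ₂ : Hom L2 L4), CommSq α₁ α₂ γ₁ γ₂ →
    ∃! δ : Hom L3 L4, CompEq δ β₁ γ₁ ∧ CompEq δ β₂ γ₂

/-- Pushable span. -/
def Pushable {L0 L1 L2 : Computon} (α₁ : Hom L0 L1) (α₂ : Hom L0 L2) : Prop :=
  (α₁.fP '' iVec α₂ ∪ α₁.fP '' oVec α₂ ⊆ inports L1 ∪ outports L1) ∧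
  (α₂.fP '' iVec α₁ ∪ α₂.fP '' oVec α₁ ⊆ inports L2 ∪ outports L2) ∧
  L0.types ⊆ L1.types ∩ L2.types ∧ L0.B ⊆ L1.B ∩ L2.B

/-- Sequentiable span. -/
def Sequentiable {L0 L1 L2 : Computon} (α₁ : Hom L0 L1) (α₂ : Hom L0 L2) : Prop :=
  IsTrivial L0 ∧ IsMono α₁ ∧ IsMono α₂ ∧
  Set.range α₁.fP ⊆ outports L1 ∧ Set.range α₂.fP ⊆ inports L2 ∧
  L0.types ⊆ L1.types ∩ L2.types ∧ L0.B ⊆ L1.B ∩ L2.B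

/-- The condition under which the pushout of a sequentiable span is a *total*
sequential computon: `α₁(P₀) = P₁⁻` and `α₂(P₀) = P₂⁺`. -/
def TotalSeq {L0 L1 L2 : Computon} (α₁ : Hom L0 L1) (α₂ : Hom L0 L2) : Prop :=
  Set.range α₁.fP = outports L1 ∧ Set.range α₂.fP = inports L2

/-- Isomorphism of computons: a computon morphism with a two-sided inverse. -/
def Isomorphic (A B : Computon) : Prop :=
  ∃ (φ : Hom A B) (ψ : Hom B A),
    ψ.fU ∘ φ.fU = id ∧ ψ.fP ∘ φ.fP = id ∧ ψ.fI ∘ φ.fI = id ∧ ψ.fO ∘ φ.fO = id ∧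
    φ.fU ∘ ψ.fU = id ∧ φ.fP ∘ ψ.fP = id ∧ φ.fI ∘ ψ.fI = id ∧ φ.fO ∘ ψ.fO = id

/-- In-marker: a monomorphism from a trivial computon whose P-image is exactly the inports. -/
def InMarker {L0 L1 : Computon} (α : Hom L0 L1) : Prop :=
  IsTrivial L0 ∧ IsMono α ∧ Set.range α.fP = inports L1

/-- Out-marker: a monomorphism from a trivial computon whose P-image is exactly the outports. -/
def OutMarker {L0 L1 : Computon} (α : Hom L0 L1) : Prop :=
  IsTrivial L0 ∧ IsMono α ∧ Set.range α.fP = outports L1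

/-- `β₁`, `β₂` exhibit their codomain as the componentwise coproduct `L1 + L2`:
the injections are monic, jointly surjective with disjoint images on every
component, and types/devices are unions. -/
def IsCoprodObj {L1 L2 C : Computon} (β₁ : Hom L1 C) (β₂ : Hom L2 C) : Prop :=
  IsMono β₁ ∧ IsMono β₂ ∧
  (∀ u, u ∈ Set.range β₁.fU ∨ u ∈ Set.range β₂.fU) ∧
  (∀ p, p ∈ Set.range β₁.fP ∨ p ∈ Set.range β₂.fP) ∧
  (∀ i, i ∈ Set.range β₁.fI ∨ i ∈ Set.range β₂.fI) ∧
  (∀ o, o ∈ Set.range β₁.fO ∨ o ∈ Set.range β₂.fO) ∧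
  Disjoint (Set.range β₁.fU) (Set.range β₂.fU) ∧
  Disjoint (Set.range β₁.fP) (Set.range β₂.fP) ∧
  Disjoint (Set.range β₁.fI) (Set.range β₂.fI) ∧
  Disjoint (Set.range β₁.fO) (Set.range β₂.fO) ∧
  C.types = L1.types ∪ L2.types ∧ C.B = L1.B ∪ L2.B

/-- `β₁`, `β₂` form a coproduct cocone in the category of computons
(universal property). -/
def IsCoproduct {L1 L2 C : Computon} (β₁ : Hom L1 C) (β₂ : Hom L2 C) : Prop :=
  ∀ (D : Computon) (γ₁ : Hom L1 D) (γ₂ : Hom L2 D),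
    ∃! δ : Hom C D, CompEq δ β₁ γ₁ ∧ CompEq δ β₂ γ₂

/-- Source vertex of an edge of the bipartite graph of a computon. -/
def edgeSrc (A : Computon) : A.I ⊕ A.O → A.U ⊕ A.P
  | Sum.inl i => Sum.inr (A.s i)
  | Sum.inr o => Sum.inl (A.sigma o)

/-- Target vertex of an edge of the bipartite graph of a computon. -/
def edgeTgt (A : Computon) : A.I ⊕ A.O → A.U ⊕ A.P
  | Sum.inl i => Sum.inl (A.tau i)
  | Sum.inr o => Sum.inr (A.t o)

/-- Connected computon: from every port in `P⁺ ∪ s(I)` there is a directed path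
of length ≥ 2 in the bipartite graph ending in an outport. -/
def Connected (A : Computon) : Prop :=
  ∀ p : A.P, p ∈ inports A ∪ Set.range A.s →
    ∃ (n : ℕ) (e : Fin (n + 2) → A.I ⊕ A.O),
      edgeSrc A (e 0) = Sum.inr p ∧
      (∀ k : Fin (n + 1), edgeTgt A (e k.castSucc) = edgeSrc A (e k.succ)) ∧
      ∃ q ∈ outports A, edgeTgt A (e (Fin.last (n + 1))) = Sum.inr q

namespace Hom

/-- The identity morphism of a computon. -/
def id (A : Computon) : Hom A A where
  fU := _root_.id
  fP := _root_.id
  fI := _root_.id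
  fO := _root_.id
  typesSub := subset_rfl
  bSub := subset_rfl
  comm_tau _ := rfl
  comm_sigma _ := rfl
  comm_s _ := rfl
  comm_t _ := rfl
  comm_c _ := rfl
  comm_r _ := rfl
  comm_f _ := rfl
  boundary p h := by simp at h

/-- Morphisms reflect interface ports. -/
theorem mem_interface_of_map_mem {A B : Computon} (α : Hom A B) {p : A.P}
    (h : α.fP p ∈ inports B ∪ outports B) : p ∈ inports A ∪ outports A := by
  refine h.imp ?_ ?_
  · rintro h ⟨o, rfl⟩
    exact h ⟨α.fO o, α.comm_t o⟩
  · rintro h ⟨i, rfl⟩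
    exact h ⟨α.fI i, α.comm_s i⟩

/-- Composition of computon morphisms. -/
def comp {A B C : Computon} (β : Hom B C) (α : Hom A B) : Hom A C where
  fU := β.fU ∘ α.fU
  fP := β.fP ∘ α.fP
  fI := β.fI ∘ α.fI
  fO := β.fO ∘ α.fO
  typesSub := α.typesSub.trans β.typesSub
  bSub := α.bSub.trans β.bSub
  comm_tau i := by simp [β.comm_tau, α.comm_tau]
  comm_sigma o := by simp [β.comm_sigma, α.comm_sigma]
  comm_s i := by simp [β.comm_s, α.comm_s]
  comm_t o := by simp [β.comm_t, α.comm_t]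
  comm_c p := by simp [β.comm_c, α.comm_c]
  comm_r i := by simp [β.comm_r, α.comm_r]
  comm_f o := by simp [β.comm_f, α.comm_f]
  boundary p h := by
    rw [Set.image_comp, Set.image_comp] at h
    rcases h with ⟨u, hu, hn⟩ | ⟨u, hu, hn⟩
    · by_cases hv : u ∈ β.fU '' preUnits B (α.fP p)
      · obtain ⟨v, hv, rfl⟩ := hv
        exact α.boundary p (.inl ⟨v, hv, fun h => hn ⟨v, h, rfl⟩⟩)
      · exact α.mem_interface_of_map_mem (β.boundary _ (.inl ⟨u, hu, hv⟩))
    · by_cases hv : u ∈ β.fU '' postUnits B (α.fP p)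
      · obtain ⟨v, hv, rfl⟩ := hv
        exact α.boundary p (.inr ⟨v, hv, fun h => hn ⟨v, h, rfl⟩⟩)
      · exact α.mem_interface_of_map_mem (β.boundary _ (.inr ⟨u, hu, hv⟩))

end Hom

/-- Open branching satisfies the identity law up to isomorphism:
if in the span of in-markers the leg λ₂⁺ : λ₀ → λ₂ is an isomorphism (λ₀ ≅ λ₂,
λ₂ trivial), then the open branching computon λ₂ ?_ρ λ₃ is isomorphic to λ₃. -/
theorem open_branching_identity (L0 L2 L3 : Computon)
    (m₂ : Hom L0 L2) (m₃ : Hom L0 L3)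
    (hm₂ : InMarker m₂) (hm₃ : InMarker m₃)
    (hiso : ∃ ψ : Hom L2 L0,
      ψ.fU ∘ m₂.fU = id ∧ ψ.fP ∘ m₂.fP = id ∧ ψ.fI ∘ m₂.fI = id ∧
      ψ.fO ∘ m₂.fO = id ∧ m₂.fU ∘ ψ.fU = id ∧ m₂.fP ∘ ψ.fP = id ∧
      m₂.fI ∘ ψ.fI = id ∧ m₂.fO ∘ ψ.fO = id)
    (Q : Computon) (β₁ : Hom L2 Q) (β₂ : Hom L3 Q)
    (hQ : IsPushout m₂ m₃ β₁ β₂) :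
    Isomorphic Q L3 := by
  obtain ⟨ψ, hU, hP, hI, hO, hU', hP', hI', hO'⟩ := hiso
  obtain ⟨⟨sU, sP, sI, sO⟩, univ⟩ := hQ
  obtain ⟨δ, ⟨⟨aU, aP, aI, aO⟩, bU, bP, bI, bO⟩, -⟩ := univ L3 (m₃.comp ψ) (Hom.id L3) (by
    simp [CommSq, Hom.comp, Hom.id, Function.comp_assoc, hU, hP, hI, hO])
  simp only [Hom.comp, Hom.id] at aU aP aI aO bU bP bI bO
  have key : β₂.comp δ = Hom.id Q := by
    refine (univ Q β₁ β₂ ⟨sU, sP, sI, sO⟩).unique ⟨?_, ?_⟩ ?_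
    · refine ⟨?_, ?_, ?_, ?_⟩ <;> simp only [Hom.comp, Function.comp_assoc]
      · rw [aU, ← Function.comp_assoc, ← sU, Function.comp_assoc, hU', Function.comp_id]
      · rw [aP, ← Function.comp_assoc, ← sP, Function.comp_assoc, hP', Function.comp_id]
      · rw [aI, ← Function.comp_assoc, ← sI, Function.comp_assoc, hI', Function.comp_id]
      · rw [aO, ← Function.comp_assoc, ← sO, Function.comp_assoc, hO', Function.comp_id]
    · simp [CompEq, Hom.comp, Function.comp_assoc, bU, bP, bI, bO]
    · simp [CompEq, Hom.id]
  exact ⟨δ, β₂, congrArg Hom.fU key, congrArg Hom.fP key, congrArg Hom.fI key,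
    congrArg Hom.fO key, bU, bP, bI, bO⟩

end Computons
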